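/- (Main Theorem for trees) Let T = (V, E) be a tree on the well-ordered variable set V with |V| = n, and let C = Π_{x∈V} x^{w(x)+1} be a monomial of degree n−1, where w(x) ∈ {−1, 0, 1, 2, ...} is the weight of vertex x and the total weight Σ_x w(x) equals −1. Then the partial divided symmetrization DS_T(C) equals sign(C) times the number of C-acceptable permutations of V. -/

import Mathlib

open MvPolynomial
open scoped Classical

/-- Partial divided symmetrization of a polynomial `f` over the graph on the variables
`x_0 < x_1 < ... < x_{m-1}` whose (ordered) edges form the finset `E`:
`DS_G(f) = Σ_π (f ∘ π) / Π_{(x,y) ∈ E} (x_π − y_π)`,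
the sum being over all `m!` permutations of the variables. -/
noncomputable def DS {K : Type*} [Field K] {m : ℕ} (E : Finset (Fin m × Fin m))
    (f : MvPolynomial (Fin m) K) : FractionRing (MvPolynomial (Fin m) K) :=
  ∑ π : Equiv.Perm (Fin m),
    algebraMap (MvPolynomial (Fin m) K) (FractionRing (MvPolynomial (Fin m) K))
        (rename (⇑π) f) /
      algebraMap (MvPolynomial (Fin m) K) (FractionRing (MvPolynomial (Fin m) K))
        (rename (⇑π) (∏ e ∈ E, (X e.1 - X e.2)))

section Alternant

variable {K : Type*} [Field K] {m : ℕ}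

theorem X_sub_X_irreducible {i j : Fin m} (hij : i ≠ j) :
    Irreducible (X i - X j : MvPolynomial (Fin m) K) := by
  have hne : (Finsupp.single j 1 : Fin m →₀ ℕ) ≠ Finsupp.single i 1 := by
    intro h
    exact hij (Finsupp.single_left_injective one_ne_zero h).symm
  have hc : coeff (Finsupp.single i 1) (X i - X j : MvPolynomial (Fin m) K) = 1 := by
    simp [coeff_X, hne]
  apply irreducible_of_totalDegree_eq_one
  · apply le_antisymm
    · refine (totalDegree_sub _ _).trans (by simp)
    · have : Finsupp.single i 1 ∈ (X i - X j : MvPolynomial (Fin m) K).support := by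
        rw [mem_support_iff, hc]; exact one_ne_zero
      simpa using le_totalDegree this
  · intro x hx
    have := hx (Finsupp.single i 1)
    rw [hc] at this
    exact isUnit_of_dvd_one this

theorem X_sub_X_not_dvd {i j k l : Fin m} (hij : i < j) (hkl : k < l) (h : (i, j) ≠ (k, l)) :
    ¬ (X i - X j : MvPolynomial (Fin m) K) ∣ X k - X l := by
  rintro ⟨q, hq⟩
  by_cases hk : k = i ∨ k = j
  · have := congrArg (eval fun z => if z = l then (1 : K) else 0) hq
    have hl : i ≠ l ∧ j ≠ l := by
      constructor
      · rintro rfl; rcases hk with rfl | rfl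
        · exact lt_irrefl _ hkl
        · exact lt_asymm hij hkl
      · rintro rfl; rcases hk with rfl | rfl
        · exact h rfl
        · exact lt_irrefl _ hkl
    simp [hl.1, hl.2, hkl.ne] at this
  · have := congrArg (eval fun z => if z = k then (1 : K) else 0) hq
    push Not at hk
    simp [hk.1.symm, hk.2.symm, hkl.ne'] at this

/-- The product of the differences of all pairs of variables. -/
noncomputable def pairDiffProd (K : Type*) [Field K] (m : ℕ) : MvPolynomial (Fin m) K :=
  ∏ p ∈ Finset.univ.filter (fun p : Fin m × Fin m => p.1 < p.2), (X p.1 - X p.2)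

theorem pairDiffProd_dvd {f : MvPolynomial (Fin m) K}
    (h : ∀ i j : Fin m, i < j → (X i - X j : MvPolynomial (Fin m) K) ∣ f) :
    pairDiffProd K m ∣ f := by
  apply Finset.prod_dvd_of_isRelPrime
  · rintro ⟨i, j⟩ hp ⟨k, l⟩ hq hne
    simp only [Finset.coe_filter, Finset.mem_univ, true_and, Set.mem_ofPred_eq] at hp hq
    exact (X_sub_X_irreducible hp.ne).isRelPrime_iff_not_dvd.2 (X_sub_X_not_dvd hp hq hne)
  · rintro ⟨i, j⟩ hp
    exact h i j (by simpa using hp)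

theorem X_sub_X_dvd_sub_rename_swap (i j : Fin m) (f : MvPolynomial (Fin m) K) :
    (X i - X j) ∣ f - rename (Equiv.swap i j) f := by
  rw [← Ideal.mem_span_singleton, ← Ideal.Quotient.mk_eq_mk_iff_sub_mem]
  set I := Ideal.span {(X i - X j : MvPolynomial (Fin m) K)}
  have hIJ : Ideal.Quotient.mkₐ K I (X i) = Ideal.Quotient.mkₐ K I (X j) :=
    (Ideal.Quotient.mk_eq_mk_iff_sub_mem _ _).2 (Ideal.mem_span_singleton_self _)
  have : Ideal.Quotient.mkₐ K I = (Ideal.Quotient.mkₐ K I).comp (rename (Equiv.swap i j)) := by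
    apply algHom_ext
    intro k
    simp only [AlgHom.comp_apply, rename_X, Equiv.swap_apply_def]
    split_ifs with h1 h2
    · rw [h1, hIJ]
    · rw [h2, hIJ]
    · rfl
  exact congrArg (fun F => F f) this

/-- The alternating sum of a polynomial over all permutations of the variables. -/
noncomputable def alternant (f : MvPolynomial (Fin m) K) : MvPolynomial (Fin m) K :=
  ∑ π : Equiv.Perm (Fin m), (Equiv.Perm.sign π : ℤ) • rename π f

theorem pairDiffProd_dvd_alternant (f : MvPolynomial (Fin m) K) :
    pairDiffProd K m ∣ alternant f := by
  apply pairDiffProd_dvd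
  intro i j hij
  rw [← Ideal.mem_span_singleton, ← Ideal.Quotient.eq_zero_iff_mem, alternant, map_sum]
  apply Finset.sum_involution (fun π _ => Equiv.swap i j * π)
  · intro π _
    have h := X_sub_X_dvd_sub_rename_swap i j (rename π f)
    rw [← Ideal.mem_span_singleton, ← Ideal.Quotient.mk_eq_mk_iff_sub_mem, rename_rename,
      ← Equiv.Perm.coe_mul] at h
    simp [h, Equiv.Perm.sign_mul, Equiv.Perm.sign_swap hij.ne]
  · intro π _ _ h
    have : Equiv.swap i j = 1 := by simpa using h
    exact hij.ne (Equiv.swap_eq_one_iff.1 this)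
  · simp
  · simp

theorem rename_pairDiffProd (π : Equiv.Perm (Fin m)) :
    rename π (pairDiffProd K m) = (Equiv.Perm.sign π : ℤ) • pairDiffProd K m := by
  have key (σ : Equiv.Perm (Fin m)) : rename σ (pairDiffProd K m) =
      (-1) ^ (Finset.univ.filter (fun p : Fin m × Fin m => p.1 < p.2)).card *
        (Matrix.vandermonde fun i => (X (σ i) : MvPolynomial (Fin m) K)).det := by
    have hIoi (i : Fin m) : Finset.Ioi i = Finset.univ.filter fun j => i < j := by ext; simp
    simp_rw [Matrix.det_vandermonde, pairDiffProd, map_prod, ← Finset.prod_const, hIoi,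
      Finset.prod_filter, Fintype.prod_prod_type, ← Finset.prod_mul_distrib]
    refine Finset.prod_congr rfl fun i _ => Finset.prod_congr rfl fun j _ => ?_
    split_ifs <;> simp
  have h1 := key 1
  simp only [Equiv.Perm.coe_one, id_eq, rename_id_apply] at h1
  have hdet : (Matrix.vandermonde fun i => (X (π i) : MvPolynomial (Fin m) K)).det =
      (Equiv.Perm.sign π : ℤ) * (Matrix.vandermonde fun i => (X i : MvPolynomial (Fin m) K)).det :=
    Matrix.det_permute π (Matrix.vandermonde fun i => (X i : MvPolynomial (Fin m) K))
  rw [key π, h1, hdet, zsmul_eq_mul]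
  ring

theorem pairDiffProd_ne_zero : pairDiffProd K m ≠ 0 := by
  refine Finset.prod_ne_zero_iff.2 fun p hp => ?_
  exact (X_sub_X_irreducible (by simpa using (Finset.mem_filter.1 hp).2.ne)).ne_zero

theorem totalDegree_prod_X_sub_X (E : Finset (Fin m × Fin m)) (hE : ∀ e ∈ E, e.1 < e.2) :
    (∏ e ∈ E, (X e.1 - X e.2) : MvPolynomial (Fin m) K).totalDegree = E.card := by
  apply IsHomogeneous.totalDegree
  · have := IsHomogeneous.prod E (fun e => (X e.1 - X e.2 : MvPolynomial (Fin m) K)) (fun _ => 1)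
      fun e _ => (isHomogeneous_X K e.1).sub (isHomogeneous_X K e.2)
    simpa using this
  · exact Finset.prod_ne_zero_iff.2 fun e he => (X_sub_X_irreducible (hE e he).ne).ne_zero

/-- The divided symmetrization of a polynomial whose degree is at most the number of edges is a
constant, in every field in which it can be evaluated. -/
theorem exists_const_divided_symmetrization (E : Finset (Fin m × Fin m))
    (hE : ∀ e ∈ E, e.1 < e.2) (f : MvPolynomial (Fin m) K) (hf : f.totalDegree ≤ E.card) :
    ∃ c : K, ∀ {L : Type*} [Field L] (ψ : MvPolynomial (Fin m) K →+* L),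
      (∀ i j : Fin m, ψ (X i) = ψ (X j) → i = j) →
      ∑ π : Equiv.Perm (Fin m), ψ (rename π f) / ψ (rename π (∏ e ∈ E, (X e.1 - X e.2))) =
        ψ (C c) := by
  obtain ⟨P, hP⟩ : (∏ e ∈ E, (X e.1 - X e.2) : MvPolynomial (Fin m) K) ∣ pairDiffProd K m :=
    Finset.prod_dvd_prod_of_subset _ _ _ fun e he => by simpa using hE e he
  have hV := pairDiffProd_ne_zero (K := K) (m := m)
  have hQ0 : (∏ e ∈ E, (X e.1 - X e.2) : MvPolynomial (Fin m) K) ≠ 0 := by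
    intro h; rw [h, zero_mul] at hP; exact hV hP
  have hP0 : P ≠ 0 := by
    intro h; rw [h, mul_zero] at hP; exact hV hP
  obtain ⟨M, hM⟩ := pairDiffProd_dvd_alternant (f * P)
  obtain ⟨c, rfl⟩ : ∃ c, M = C c := by
    refine ⟨_, totalDegree_eq_zero_iff_eq_C.1 ?_⟩
    by_cases hM0 : M = 0
    · simp [hM0]
    have h1 : (alternant (f * P)).totalDegree ≤ (f * P).totalDegree := by
      refine totalDegree_finsetSum_le fun π _ => ?_
      exact (totalDegree_smul_le _ _).trans (totalDegree_rename_le _ _)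
    have h2 := totalDegree_mul f P
    have h3 := totalDegree_mul_of_isDomain hV hM0
    have h4 := totalDegree_mul_of_isDomain hQ0 hP0
    rw [← hM] at h3
    rw [← hP, totalDegree_prod_X_sub_X E hE] at h4
    omega
  refine ⟨c, fun {L} _ ψ hψ => ?_⟩
  have hψV : ψ (pairDiffProd K m) ≠ 0 := by
    rw [pairDiffProd, map_prod]
    refine Finset.prod_ne_zero_iff.2 fun p hp h => ?_
    rw [map_sub, sub_eq_zero] at h
    exact (Finset.mem_filter.1 hp).2.ne (hψ _ _ h)
  have hterm (π : Equiv.Perm (Fin m)) :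
      ψ (rename π f) / ψ (rename π (∏ e ∈ E, (X e.1 - X e.2))) =
        ψ ((Equiv.Perm.sign π : ℤ) • rename π (f * P)) / ψ (pairDiffProd K m) := by
    have h := congrArg ψ (rename_pairDiffProd (K := K) π)
    rw [hP, map_mul, map_mul, ← hP, zsmul_eq_mul, map_mul, map_intCast] at h
    have hs : ((Equiv.Perm.sign π : ℤ) : L) * (Equiv.Perm.sign π : ℤ) = 1 := by
      rw [← Int.cast_mul, ← Units.val_mul, Int.units_mul_self]; simp
    have hne : ψ (rename π (∏ e ∈ E, (X e.1 - X e.2))) ≠ 0 := by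
      intro h0
      rw [h0, zero_mul] at h
      exact mul_ne_zero (left_ne_zero_of_mul_eq_one hs) hψV h.symm
    rw [div_eq_div_iff hne hψV, zsmul_eq_mul, map_mul, map_mul, map_mul, map_intCast]
    linear_combination (-ψ (rename π f) * (Equiv.Perm.sign π : ℤ)) * h -
      ψ (rename π f) * ψ (pairDiffProd K m) * hs
  simp_rw [hterm]
  rw [← Finset.sum_div, ← map_sum, div_eq_iff hψV, ← map_mul, mul_comm (C c), ← hM]
  rfl

end Alternant

section GeometricSeries

variable {K : Type*} [Field K] {Γ : Type*} [AddCommGroup Γ] [LinearOrder Γ] [IsOrderedAddMonoid Γ]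

/-- The geometric Hahn series `∑ k, t ^ (p + k • d)`. -/
noncomputable def geomHahn (K : Type*) [Field K] (p d : Γ) (hd : 0 < d) : HahnSeries Γ K where
  coeff a := if ∃ k : ℕ, a = p + k • d then 1 else 0
  isPWO_support' := by
    have : Monotone fun k : ℕ => p + k • d := fun k l hkl =>
      add_le_add_right (nsmul_le_nsmul_left hd.le hkl) p
    refine ((Set.IsWF.isPWO (s := (Set.univ : Set ℕ))
      (Set.isWF_univ_iff.2 inferInstance)).image_of_monotone this).mono ?_
    intro a ha
    simp only [Function.mem_support, ne_eq, ite_eq_right_iff, one_ne_zero, imp_false,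
      not_not] at ha
    obtain ⟨k, rfl⟩ := ha
    exact ⟨k, trivial, rfl⟩

theorem coeff_geomHahn (p d : Γ) (hd : 0 < d) (a : Γ) :
    (geomHahn K p d hd).coeff a = if ∃ k : ℕ, a = p + k • d then 1 else 0 := rfl

theorem single_sub_single_mul_geomHahn (a b : Γ) (hab : a < b) :
    (HahnSeries.single a 1 - HahnSeries.single b 1) *
      geomHahn K (-a) (b - a) (sub_pos.2 hab) = 1 := by
  ext c
  rw [sub_mul, HahnSeries.coeff_sub, HahnSeries.coeff_single_mul, HahnSeries.coeff_single_mul,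
    coeff_geomHahn, coeff_geomHahn, HahnSeries.coeff_one]
  have hd : 0 < b - a := sub_pos.2 hab
  have h1 : (∃ k : ℕ, c - a = -a + k • (b - a)) ↔ ∃ k : ℕ, c = k • (b - a) :=
    exists_congr fun k => by rw [neg_add_eq_sub, sub_left_inj]
  have h2 : (∃ k : ℕ, c - b = -a + k • (b - a)) ↔ ∃ k : ℕ, c = (k + 1) • (b - a) :=
    exists_congr fun k => by
      rw [succ_nsmul, sub_eq_iff_eq_add, show -a + k • (b - a) + b = k • (b - a) + (b - a) by abel]
  simp only [h1, h2]
  by_cases hc : c = 0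
  · subst hc
    rw [if_pos ⟨0, by simp⟩, if_neg, if_pos rfl]
    · simp
    · rintro ⟨k, hk⟩
      exact (nsmul_pos hd k.succ_ne_zero).ne hk
  · rw [if_neg hc]
    have : (∃ k : ℕ, c = k • (b - a)) ↔ ∃ k : ℕ, c = (k + 1) • (b - a) := by
      constructor
      · rintro ⟨k, hk⟩
        cases k with
        | zero => simp at hk; exact absurd hk hc
        | succ k => exact ⟨k, hk⟩
      · rintro ⟨k, hk⟩
        exact ⟨k + 1, hk⟩
    simp [this]

theorem inv_single_sub_single_of_lt (a b : Γ) (hab : a < b) :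
    (HahnSeries.single a (1 : K) - HahnSeries.single b 1)⁻¹ =
      geomHahn K (-a) (b - a) (sub_pos.2 hab) :=
  inv_eq_of_mul_eq_one_right (single_sub_single_mul_geomHahn a b hab)

/-- If the directions `d i` are independent, as witnessed by the functionals `φ i`, then every
coefficient of a product of geometric series is `0` or `1`. -/
theorem coeff_prod_geomHahn {ι : Type*} (p d : ι → Γ) (hd : ∀ i, 0 < d i) (φ : ι → Γ →+ ℤ)
    (s : Finset ι) (hφ : ∀ i ∈ s, φ i (d i) ≠ 0)
    (hφ' : ∀ i ∈ s, ∀ j ∈ s, i ≠ j → φ i (d j) = 0) (a : Γ) :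
    (∏ i ∈ s, geomHahn K (p i) (d i) (hd i)).coeff a =
      if ∃ k : ι → ℕ, a = ∑ i ∈ s, (p i + k i • d i) then 1 else 0 := by
  induction s using Finset.induction_on generalizing a with
  | empty => simp [HahnSeries.coeff_one]
  | insert i s hi ih =>
    have ih := ih (fun j hj => hφ j (Finset.mem_insert_of_mem hj))
      (fun j hj l hl => hφ' j (Finset.mem_insert_of_mem hj) l (Finset.mem_insert_of_mem hl))
    have hsum (k : ι → ℕ) : ∑ j ∈ insert i s, (p j + k j • d j) =
        (p i + k i • d i) + ∑ j ∈ s, (p j + k j • d j) := Finset.sum_insert hi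
    simp only [hsum]
    rw [Finset.prod_insert hi, HahnSeries.coeff_mul]
    have hval (k : ι → ℕ) : φ i (∑ j ∈ s, (p j + k j • d j)) = φ i (∑ j ∈ s, p j) := by
      rw [map_sum, map_sum]
      refine Finset.sum_congr rfl fun j hj => ?_
      rw [map_add, map_nsmul, hφ' i (Finset.mem_insert_self _ _) j (Finset.mem_insert_of_mem hj)
        (by rintro rfl; exact hi hj), smul_zero, add_zero]
    split_ifs with h
    · obtain ⟨k, rfl⟩ := h
      rw [Finset.sum_eq_single (p i + k i • d i, ∑ j ∈ s, (p j + k j • d j))]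
      · simp only [ih, coeff_geomHahn]
        rw [if_pos ⟨_, rfl⟩, if_pos ⟨_, rfl⟩, one_mul]
      · rintro ⟨b, c⟩ hbc hne
        rw [Finset.mem_antidiagonal] at hbc
        obtain ⟨hb, hc, hsum⟩ := hbc
        simp only [HahnSeries.mem_support, coeff_geomHahn, ih, ne_eq, ite_eq_right_iff,
          one_ne_zero, imp_false, not_not] at hb hc
        obtain ⟨l, rfl⟩ := hb
        obtain ⟨k', rfl⟩ := hc
        have h := congrArg (φ i) hsum
        simp only [map_add, hval, map_nsmul] at h
        have hl : (l : ℤ) = k i := by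
          apply mul_right_cancel₀ (hφ i (Finset.mem_insert_self _ _))
          simpa using h
        have hl : l = k i := by exact_mod_cast hl
        subst hl
        simp only [add_right_inj] at hsum
        exact absurd (by rw [hsum]) hne
      · intro h
        by_contra h0
        apply h
        rw [Finset.mem_antidiagonal]
        exact ⟨left_ne_zero_of_mul h0, right_ne_zero_of_mul h0, rfl⟩
    · refine Finset.sum_eq_zero ?_
      rintro ⟨b, c⟩ hbc
      rw [Finset.mem_antidiagonal] at hbc
      obtain ⟨hb, hc, hsum⟩ := hbc
      simp only [HahnSeries.mem_support, coeff_geomHahn, ih, ne_eq, ite_eq_right_iff,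
        one_ne_zero, imp_false, not_not] at hb hc
      obtain ⟨l, rfl⟩ := hb
      obtain ⟨k', rfl⟩ := hc
      refine absurd ⟨Function.update k' i l, ?_⟩ h
      rw [← hsum, Function.update_self]
      congr 1
      refine Finset.sum_congr rfl fun j hj => ?_
      rw [Function.update_of_ne (by rintro rfl; exact hi hj)]

end GeometricSeries

/-- The exponent of the `i`-th variable: it increases with `i` in the lexicographic order, so that
earlier variables dominate later ones. -/
def varExponent {n : ℕ} (i : Fin n) : Lex (Fin n → ℤ) := toLex (Pi.single i (-1))

theorem varExponent_strictMono {n : ℕ} : StrictMono (varExponent (n := n)) := by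
  intro i j hij
  refine ⟨i, fun k hk => ?_, ?_⟩
  · change (Pi.single i (-1) : Fin n → ℤ) k = (Pi.single j (-1) : Fin n → ℤ) k
    rw [Pi.single_eq_of_ne hk.ne, Pi.single_eq_of_ne (hk.trans hij).ne]
  · change (Pi.single i (-1) : Fin n → ℤ) i < (Pi.single j (-1) : Fin n → ℤ) i
    rw [Pi.single_eq_same, Pi.single_eq_of_ne hij.ne]
    norm_num

section Tree

theorem card_orderedEdges_add_one_of_isTree {V : Type*} [Fintype V] [LinearOrder V]
    (G : SimpleGraph V) (E : Finset (V × V)) (hE : ∀ e ∈ E, e.1 < e.2)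
    (hadj : ∀ i j, G.Adj i j ↔ (i, j) ∈ E ∨ (j, i) ∈ E) (hG : G.IsTree) :
    E.card + 1 = Fintype.card V := by
  rw [← hG.card_edgeFinset, add_left_inj]
  refine Finset.card_bij (fun e _ => s(e.1, e.2)) ?_ ?_ ?_
  · rintro ⟨i, j⟩ he
    simp [hadj, he]
  · rintro ⟨i, j⟩ he ⟨k, l⟩ he' h
    have h1 := hE _ he
    have h2 := hE _ he'
    rcases Sym2.eq_iff.1 h with ⟨rfl, rfl⟩ | ⟨rfl, rfl⟩
    · rfl
    · exact absurd h1 (lt_asymm h2)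
  · intro e
    induction e with
    | h i j =>
      intro he
      rw [SimpleGraph.mem_edgeFinset, SimpleGraph.mem_edgeSet, hadj] at he
      rcases he with he | he
      · exact ⟨_, he, rfl⟩
      · exact ⟨_, he, Sym2.eq_swap⟩

variable {n : ℕ} (T : SimpleGraph (Fin n)) (E : Finset (Fin n × Fin n))

/-- The vertices of the component of `T ∖ e` containing the larger endpoint of the edge `e`. -/
noncomputable def upperComponent (e : Fin n × Fin n) : Finset (Fin n) :=
  Finset.univ.filter fun z => (T.deleteEdges {s(e.1, e.2)}).Reachable e.2 z

variable {T E}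

theorem mem_upperComponent {e : Fin n × Fin n} {z : Fin n} :
    z ∈ upperComponent T e ↔ (T.deleteEdges {s(e.1, e.2)}).Reachable e.2 z := by
  simp [upperComponent]

theorem snd_mem_upperComponent (e : Fin n × Fin n) : e.2 ∈ upperComponent T e :=
  mem_upperComponent.2 .rfl

theorem fst_notMem_upperComponent (hadj : ∀ i j : Fin n, T.Adj i j ↔ (i, j) ∈ E ∨ (j, i) ∈ E)
    (hT : T.IsAcyclic) {e : Fin n × Fin n} (he : e ∈ E) : e.1 ∉ upperComponent T e := by
  rw [mem_upperComponent, SimpleGraph.reachable_comm]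
  exact SimpleGraph.isAcyclic_iff_forall_adj_isBridge.1 hT ((hadj e.1 e.2).2 (Or.inl he))

theorem deleteEdges_adj_iff (hE : ∀ e ∈ E, e.1 < e.2)
    (hadj : ∀ i j : Fin n, T.Adj i j ↔ (i, j) ∈ E ∨ (j, i) ∈ E)
    {e : Fin n × Fin n} (he : e ∈ E) (i j : Fin n) :
    (T.deleteEdges {s(e.1, e.2)}).Adj i j ↔ (i, j) ∈ E.erase e ∨ (j, i) ∈ E.erase e := by
  obtain ⟨x, y⟩ := e
  have hxy := hE _ he
  have h1 : (i, j) ∈ E → i < j := fun h => hE _ h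
  have h2 : (j, i) ∈ E → j < i := fun h => hE _ h
  simp only [SimpleGraph.deleteEdges_adj, hadj, Set.mem_singleton_iff, Sym2.eq_iff,
    Finset.mem_erase, ne_eq, Prod.mk.injEq]
  grind

theorem fst_mem_upperComponent_iff (hE : ∀ e ∈ E, e.1 < e.2)
    (hadj : ∀ i j : Fin n, T.Adj i j ↔ (i, j) ∈ E ∨ (j, i) ∈ E)
    {e e' : Fin n × Fin n} (he : e ∈ E) (he' : e' ∈ E) (hne : e' ≠ e) :
    e'.1 ∈ upperComponent T e ↔ e'.2 ∈ upperComponent T e := by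
  have h : (T.deleteEdges {s(e.1, e.2)}).Adj e'.1 e'.2 :=
    (deleteEdges_adj_iff hE hadj he _ _).2 (Or.inl (Finset.mem_erase.2 ⟨hne, he'⟩))
  rw [mem_upperComponent, mem_upperComponent]
  exact ⟨fun h' => h'.trans h.reachable, fun h' => h'.trans h.symm.reachable⟩

theorem card_edges_upperComponent (hE : ∀ e ∈ E, e.1 < e.2)
    (hadj : ∀ i j : Fin n, T.Adj i j ↔ (i, j) ∈ E ∨ (j, i) ∈ E) (hT : T.IsAcyclic)
    {e : Fin n × Fin n} (he : e ∈ E) :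
    ((E.erase e).filter fun e' => e'.2 ∈ upperComponent T e).card + 1 =
      (upperComponent T e).card := by
  set T' := T.deleteEdges {s(e.1, e.2)}
  set c := T'.connectedComponentMk e.2
  have hc (z : Fin n) : z ∈ c ↔ z ∈ upperComponent T e := by
    rw [mem_upperComponent, SimpleGraph.reachable_comm]
    exact SimpleGraph.ConnectedComponent.eq
  have htree : c.toSimpleGraph.IsTree :=
    (hT.anti (SimpleGraph.deleteEdges_le _)).isTree_connectedComponent c
  have h := card_orderedEdges_add_one_of_isTree c.toSimpleGraph
    (Finset.univ.filter fun p : c × c => (p.1.1, p.2.1) ∈ E.erase e)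
    (by
      rintro ⟨i, j⟩ h
      exact hE _ (Finset.mem_of_mem_erase (Finset.mem_filter.1 h).2))
    (by
      rintro ⟨i, hi⟩ ⟨j, hj⟩
      rw [SimpleGraph.ConnectedComponent.toSimpleGraph_adj c hi hj, deleteEdges_adj_iff hE hadj he]
      simp)
    htree
  have hcard : Fintype.card c = (upperComponent T e).card :=
    Fintype.card_of_subtype _ fun z => (hc z).symm
  rw [← hcard, ← h, add_left_inj]
  symm
  refine Finset.card_bij (fun p _ => (p.1.1, p.2.1)) ?_ ?_ ?_
  · rintro ⟨i, j⟩ h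
    rw [Finset.mem_filter] at h ⊢
    exact ⟨h.2, (hc _).1 j.2⟩
  · rintro ⟨⟨i, hi⟩, ⟨j, hj⟩⟩ _ ⟨⟨k, hk⟩, ⟨l, hl⟩⟩ _ h
    simpa using h
  · rintro ⟨i, j⟩ h
    rw [Finset.mem_filter, Finset.mem_erase] at h
    have hi := (fst_mem_upperComponent_iff hE hadj he h.1.2 h.1.1).2 h.2
    exact ⟨(⟨i, (hc _).2 hi⟩, ⟨j, (hc _).2 h.2⟩), by simp [h.1.1, h.1.2], rfl⟩

/-- A function on the vertices of a tree whose sum is zero over every component left after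
deleting an edge vanishes. -/
theorem eq_zero_of_sum_upperComponent_eq_zero (hE : ∀ e ∈ E, e.1 < e.2)
    (hadj : ∀ i j : Fin n, T.Adj i j ↔ (i, j) ∈ E ∨ (j, i) ∈ E) (hT : T.IsTree)
    (β : Fin n → ℤ) (htot : ∑ z, β z = 0) (hβ : ∀ e ∈ E, ∑ z ∈ upperComponent T e, β z = 0)
    (x : Fin n) : β x = 0 := by
  let h : Fin n → ℤ := fun z => if z = x then 1 else 0
  let ind (e : Fin n × Fin n) (z : Fin n) : ℤ := if z ∈ upperComponent T e then 1 else 0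
  let g (z : Fin n) : ℤ := h z - ∑ e ∈ E, (h e.2 - h e.1) * ind e z
  have hedge (e : Fin n × Fin n) (he : e ∈ E) : g e.1 = g e.2 := by
    have : ∑ e' ∈ E, (h e'.2 - h e'.1) * (ind e' e.2 - ind e' e.1) = h e.2 - h e.1 := by
      rw [Finset.sum_eq_single_of_mem e he]
      · simp [ind, snd_mem_upperComponent, fst_notMem_upperComponent hadj hT.isAcyclic he]
      · intro e' he' hne
        simp [ind, fst_mem_upperComponent_iff hE hadj he' he hne.symm]
    simp only [mul_sub, Finset.sum_sub_distrib] at this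
    simp only [g]
    linarith
  have hconst (a b : Fin n) : g a = g b := by
    obtain ⟨p⟩ := hT.connected.preconnected a b
    induction p with
    | nil => rfl
    | cons hab _ ih =>
      rw [← ih]
      rcases (hadj _ _).1 hab with he | he
      · exact hedge _ he
      · exact (hedge _ he).symm
  have hh (z : Fin n) : h z = g x + ∑ e ∈ E, (h e.2 - h e.1) * ind e z := by
    rw [hconst x z]; simp [g]
  calc β x = ∑ z, β z * h z := by simp [h]
    _ = (∑ z, β z) * g x + ∑ e ∈ E, (h e.2 - h e.1) * ∑ z, β z * ind e z := by
      rw [Finset.sum_congr rfl fun z _ => congrArg (β z * ·) (hh z)]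
      simp_rw [mul_add, Finset.sum_add_distrib, ← Finset.sum_mul, Finset.mul_sum]
      rw [Finset.sum_comm]
      congr 1
      refine Finset.sum_congr rfl fun e _ => Finset.sum_congr rfl fun z _ => ?_
      ring
    _ = 0 := by
      rw [htot, zero_mul, zero_add]
      refine Finset.sum_eq_zero fun e he => ?_
      have := hβ e he
      simp only [ind, mul_ite, mul_one, mul_zero, Finset.sum_ite_mem, Finset.univ_inter, this]

end Tree

section Expansion

variable {K : Type*} [Field K] {n : ℕ}

/-- The embedding of polynomials in the Hahn series in which earlier variables dominate. -/
noncomputable def toHahn (K : Type*) [Field K] (n : ℕ) :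
    MvPolynomial (Fin n) K →+* HahnSeries (Lex (Fin n → ℤ)) K :=
  eval₂Hom HahnSeries.C fun i => HahnSeries.single (varExponent i) 1

theorem toHahn_X (i : Fin n) :
    toHahn K n (X i) = HahnSeries.single (varExponent i) 1 := by
  simp [toHahn]

theorem toHahn_C (c : K) : toHahn K n (C c) = HahnSeries.C c := by
  simp [toHahn]

theorem toHahn_X_injective (i j : Fin n) (h : toHahn K n (X i) = toHahn K n (X j)) : i = j := by
  rw [toHahn_X, toHahn_X] at h
  apply varExponent_strictMono.injective
  by_contra hne
  have := congrArg (fun f => HahnSeries.coeff f (varExponent i)) h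
  simp [HahnSeries.coeff_single_of_ne hne] at this

theorem toHahn_rename_monomial (π : Equiv.Perm (Fin n)) (k : Fin n → ℕ) :
    toHahn K n (rename π (∏ x, X x ^ k x)) =
      HahnSeries.single (∑ x, k x • varExponent (π x)) 1 := by
  have (s : Finset (Fin n)) : ∏ x ∈ s, HahnSeries.single (k x • varExponent (π x)) (1 : K) =
      HahnSeries.single (∑ x ∈ s, k x • varExponent (π x)) 1 := by
    induction s using Finset.induction_on with
    | empty => simp
    | insert i s hi ih =>
      rw [Finset.prod_insert hi, Finset.sum_insert hi, ih, HahnSeries.single_mul_single, one_mul]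
  simp only [map_prod, map_pow, rename_X, toHahn_X, HahnSeries.single_pow, one_pow, this]

/-- The endpoint of `e` whose image under `π` is the dominant variable. -/
def dominantEnd (π : Equiv.Perm (Fin n)) (e : Fin n × Fin n) : Fin n :=
  if π e.1 < π e.2 then e.1 else e.2

/-- The endpoint of `e` whose image under `π` is the dominated variable. -/
def dominatedEnd (π : Equiv.Perm (Fin n)) (e : Fin n × Fin n) : Fin n :=
  if π e.1 < π e.2 then e.2 else e.1

theorem dominantEnd_lt (π : Equiv.Perm (Fin n)) {e : Fin n × Fin n} (he : e.1 < e.2) :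
    π (dominantEnd π e) < π (dominatedEnd π e) := by
  unfold dominantEnd dominatedEnd
  split_ifs with h
  · exact h
  · exact lt_of_le_of_ne (not_lt.1 h) fun h' => he.ne' (π.injective h')

theorem varExponent_dominant_pos (π : Equiv.Perm (Fin n)) {e : Fin n × Fin n} (he : e.1 < e.2) :
    0 < varExponent (π (dominatedEnd π e)) - varExponent (π (dominantEnd π e)) :=
  sub_pos.2 (varExponent_strictMono (dominantEnd_lt π he))

theorem inv_toHahn_rename_X_sub_X (π : Equiv.Perm (Fin n)) {e : Fin n × Fin n} (he : e.1 < e.2) :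
    (toHahn K n (rename π (X e.1 - X e.2)))⁻¹ =
      HahnSeries.single 0 (if π e.1 < π e.2 then 1 else -1) *
        geomHahn K (-varExponent (π (dominantEnd π e)))
          (varExponent (π (dominatedEnd π e)) - varExponent (π (dominantEnd π e)))
          (varExponent_dominant_pos π he) := by
  rw [← inv_single_sub_single_of_lt _ _ (varExponent_strictMono (dominantEnd_lt π he))]
  simp only [map_sub, rename_X, toHahn_X]
  unfold dominantEnd dominatedEnd
  split_ifs with h
  · rw [HahnSeries.single_zero_one, one_mul]
  · rw [HahnSeries.single_neg, HahnSeries.single_zero_one, neg_one_mul, ← neg_sub]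
    exact inv_neg

theorem toHahn_div_eq (E : Finset (Fin n × Fin n)) (hE : ∀ e ∈ E, e.1 < e.2)
    (π : Equiv.Perm (Fin n)) (k : Fin n → ℕ) :
    toHahn K n (rename π (∏ x, X x ^ k x)) /
        toHahn K n (rename π (∏ e ∈ E, (X e.1 - X e.2))) =
      HahnSeries.single (∑ x, k x • varExponent (π x))
          ((-1) ^ (E.filter fun e => ¬ π e.1 < π e.2).card) *
        ∏ e : E, geomHahn K (-varExponent (π (dominantEnd π e.1)))
          (varExponent (π (dominatedEnd π e.1)) - varExponent (π (dominantEnd π e.1)))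
          (varExponent_dominant_pos π (hE e.1 e.2)) := by
  have hsign : ∏ e : E, HahnSeries.single (0 : Lex (Fin n → ℤ))
      (if π e.1.1 < π e.1.2 then (1 : K) else -1) =
      HahnSeries.single 0 ((-1) ^ (E.filter fun e => ¬ π e.1 < π e.2).card) := by
    rw [Finset.prod_coe_sort E fun e => HahnSeries.single (0 : Lex (Fin n → ℤ))
      (if π e.1 < π e.2 then (1 : K) else -1)]
    change ∏ e ∈ E, HahnSeries.C (if π e.1 < π e.2 then (1 : K) else -1) = HahnSeries.C _
    rw [← map_prod, Finset.prod_ite, Finset.prod_const_one, one_mul, Finset.prod_const]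
  rw [toHahn_rename_monomial, div_eq_mul_inv, map_prod, map_prod, ← Finset.prod_inv_distrib,
    ← Finset.prod_coe_sort]
  rw [Finset.prod_congr rfl fun (e : E) _ => inv_toHahn_rename_X_sub_X (K := K) π (hE e.1 e.2),
    Finset.prod_mul_distrib, hsign, ← mul_assoc, HahnSeries.single_mul_single, add_zero, one_mul]

/-- The sum of the coordinates, read through `π`, over a set of vertices. -/
def coordSum (π : Equiv.Perm (Fin n)) (S : Finset (Fin n)) : Lex (Fin n → ℤ) →+ ℤ where
  toFun a := ∑ z ∈ S, ofLex a (π z)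
  map_zero' := Finset.sum_const_zero
  map_add' _ _ := Finset.sum_add_distrib

theorem coordSum_varExponent (π : Equiv.Perm (Fin n)) (S : Finset (Fin n)) (x : Fin n) :
    coordSum π S (varExponent (π x)) = -(if x ∈ S then 1 else 0) := by
  simp [coordSum, varExponent, Pi.single_apply, apply_ite]

end Expansion

section ConstantTerm

variable {K : Type*} [Field K] {n : ℕ} {E : Finset (Fin n × Fin n)} {T : SimpleGraph (Fin n)}

theorem coordSum_direction_of_ne (hE : ∀ e ∈ E, e.1 < e.2)
    (hadj : ∀ i j : Fin n, T.Adj i j ↔ (i, j) ∈ E ∨ (j, i) ∈ E) (π : Equiv.Perm (Fin n))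
    {e e' : Fin n × Fin n} (he : e ∈ E) (he' : e' ∈ E) (hne : e' ≠ e) :
    coordSum π (upperComponent T e)
      (varExponent (π (dominatedEnd π e')) - varExponent (π (dominantEnd π e'))) = 0 := by
  have := fst_mem_upperComponent_iff hE hadj he he' hne
  rw [map_sub, coordSum_varExponent, coordSum_varExponent]
  unfold dominatedEnd dominantEnd
  split_ifs <;> simp_all

theorem coordSum_direction_self
    (hadj : ∀ i j : Fin n, T.Adj i j ↔ (i, j) ∈ E ∨ (j, i) ∈ E) (hT : T.IsTree)
    (π : Equiv.Perm (Fin n)) {e : Fin n × Fin n} (he : e ∈ E) :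
    coordSum π (upperComponent T e)
      (varExponent (π (dominatedEnd π e)) - varExponent (π (dominantEnd π e))) =
      if π e.1 < π e.2 then -1 else 1 := by
  have h1 := fst_notMem_upperComponent hadj hT.isAcyclic he
  have h2 := snd_mem_upperComponent (T := T) e
  rw [map_sub, coordSum_varExponent, coordSum_varExponent]
  unfold dominatedEnd dominantEnd
  split_ifs <;> simp_all

theorem coordSum_sum_dominant (hE : ∀ e ∈ E, e.1 < e.2)
    (hadj : ∀ i j : Fin n, T.Adj i j ↔ (i, j) ∈ E ∨ (j, i) ∈ E) (hT : T.IsTree)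
    (π : Equiv.Perm (Fin n)) {e : Fin n × Fin n} (he : e ∈ E) :
    coordSum π (upperComponent T e) (∑ e' ∈ E, -varExponent (π (dominantEnd π e'))) =
      (upperComponent T e).card - if π e.1 < π e.2 then 1 else 0 := by
  have h1 := fst_notMem_upperComponent hadj hT.isAcyclic he
  have h2 := snd_mem_upperComponent (T := T) e
  have hcard := card_edges_upperComponent hE hadj hT.isAcyclic he
  have hothers : ∑ e' ∈ E.erase e,
      coordSum π (upperComponent T e) (-varExponent (π (dominantEnd π e'))) =
        ((E.erase e).filter fun e' => e'.2 ∈ upperComponent T e).card := by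
    rw [Finset.natCast_card_filter]
    refine Finset.sum_congr rfl fun e' he' => ?_
    rw [Finset.mem_erase] at he'
    have := fst_mem_upperComponent_iff hE hadj he he'.2 he'.1
    rw [map_neg, coordSum_varExponent, neg_neg]
    unfold dominantEnd
    split_ifs <;> simp_all
  rw [map_sum, ← Finset.add_sum_erase E _ he, hothers, map_neg, coordSum_varExponent, neg_neg,
    ← hcard]
  unfold dominantEnd
  split_ifs <;> first | contradiction | (push_cast; ring)

theorem coordSum_monomial (π : Equiv.Perm (Fin n)) (S : Finset (Fin n)) (w : Fin n → ℤ)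
    (hw : ∀ x, -1 ≤ w x) :
    coordSum π S (0 - ∑ x, (w x + 1).toNat • varExponent (π x)) = ∑ x ∈ S, w x + S.card := by
  have h (x : Fin n) : (((w x + 1).toNat : ℕ) : ℤ) = w x + 1 :=
    Int.toNat_of_nonneg (by linarith [hw x])
  simp only [zero_sub, map_neg, map_sum, map_nsmul, coordSum_varExponent]
  simp only [nsmul_eq_mul, h]
  simp [Finset.sum_add_distrib]

/-- The exponent equation governing the constant term of a summand is solvable exactly when the
permutation is acceptable. -/
theorem exists_exponents_iff_acceptable (hE : ∀ e ∈ E, e.1 < e.2)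
    (hadj : ∀ i j : Fin n, T.Adj i j ↔ (i, j) ∈ E ∨ (j, i) ∈ E) (hT : T.IsTree)
    (w : Fin n → ℤ) (hw1 : ∀ x, -1 ≤ w x) (hw : ∑ x, w x = -1) (π : Equiv.Perm (Fin n)) :
    (∃ k : E → ℕ, 0 - ∑ x, (w x + 1).toNat • varExponent (π x) =
        ∑ e : E, (-varExponent (π (dominantEnd π e.1)) + k e •
          (varExponent (π (dominatedEnd π e.1)) - varExponent (π (dominantEnd π e.1))))) ↔
      ∀ e ∈ E, (π e.1 < π e.2 ↔ ∑ z ∈ upperComponent T e, w z < 0) := by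
  have heval (k : E → ℕ) (e : E) : coordSum π (upperComponent T e.1)
      (∑ e' : E, (-varExponent (π (dominantEnd π e'.1)) + k e' •
        (varExponent (π (dominatedEnd π e'.1)) - varExponent (π (dominantEnd π e'.1))))) =
      (upperComponent T e.1).card +
        if π e.1.1 < π e.1.2 then -1 - (k e : ℤ) else (k e : ℤ) := by
    rw [Finset.sum_add_distrib, map_add,
      Finset.sum_coe_sort E fun e' => -varExponent (π (dominantEnd π e')),
      coordSum_sum_dominant hE hadj hT π e.2, map_sum, Finset.sum_eq_single e, map_nsmul,
      coordSum_direction_self hadj hT π e.2]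
    · split_ifs <;> simp
      ring
    · intro e' _ hne
      rw [map_nsmul, coordSum_direction_of_ne hE hadj π e.2 e'.2 (Subtype.coe_ne_coe.2 hne),
        smul_zero]
    · simp
  constructor
  · rintro ⟨k, hk⟩ e he
    have h := congrArg (coordSum π (upperComponent T e)) hk
    rw [heval k ⟨e, he⟩, coordSum_monomial π _ w hw1] at h
    dsimp only at h
    split_ifs at h with hlt
    · simp only [hlt, true_iff]; omega
    · simp only [hlt, false_iff]; omega
  · intro hacc
    let k (e : E) : ℕ :=
      if π e.1.1 < π e.1.2 then (-1 - ∑ z ∈ upperComponent T e.1, w z).toNat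
      else (∑ z ∈ upperComponent T e.1, w z).toNat
    refine ⟨k, ?_⟩
    rw [← sub_eq_zero]
    generalize hdiff : (_ - _ : Lex (Fin n → ℤ)) = diff
    have hzero : ∀ x, ofLex diff (π x) = 0 := by
      refine eq_zero_of_sum_upperComponent_eq_zero hE hadj hT _ ?_ ?_
      · change coordSum π Finset.univ diff = 0
        have hcard := card_orderedEdges_add_one_of_isTree T E hE hadj hT
        rw [Fintype.card_fin] at hcard
        rw [← hdiff, map_sub, coordSum_monomial π _ w hw1, hw, map_sum]
        simp only [map_add, map_neg, map_nsmul, map_sub, coordSum_varExponent]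
        simp
        omega
      · intro e he
        change coordSum π (upperComponent T e) diff = 0
        rw [← hdiff, map_sub, coordSum_monomial π _ w hw1, heval k ⟨e, he⟩]
        have := hacc e he
        simp only [k]
        split_ifs with hlt
        · have := this.1 hlt
          omega
        · have := mt this.2 hlt
          omega
    have hz : ofLex diff = 0 := by
      funext y
      simpa using hzero (π.symm y)
    exact hz

/-- The constant term of the summand of the divided symmetrization indexed by `π`. -/
theorem coeff_zero_toHahn_div (hE : ∀ e ∈ E, e.1 < e.2)
    (hadj : ∀ i j : Fin n, T.Adj i j ↔ (i, j) ∈ E ∨ (j, i) ∈ E) (hT : T.IsTree)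
    (w : Fin n → ℤ) (hw1 : ∀ x, -1 ≤ w x) (hw : ∑ x, w x = -1) (π : Equiv.Perm (Fin n)) :
    (toHahn K n (rename π (∏ x, X x ^ (w x + 1).toNat)) /
        toHahn K n (rename π (∏ e ∈ E, (X e.1 - X e.2)))).coeff 0 =
      if ∀ e ∈ E, (π e.1 < π e.2 ↔ ∑ z ∈ upperComponent T e, w z < 0) then
        (-1) ^ (E.filter fun e => ¬ ∑ z ∈ upperComponent T e, w z < 0).card else 0 := by
  rw [toHahn_div_eq E hE, HahnSeries.coeff_single_mul,
    coeff_prod_geomHahn (fun e : E => -varExponent (π (dominantEnd π e.1)))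
      (fun e : E => varExponent (π (dominatedEnd π e.1)) - varExponent (π (dominantEnd π e.1)))
      (fun e : E => varExponent_dominant_pos π (hE e.1 e.2))
      (fun e : E => coordSum π (upperComponent T e.1))]
  · simp only [exists_exponents_iff_acceptable hE hadj hT w hw1 hw π]
    split_ifs with hacc
    · rw [mul_one, Finset.filter_congr fun e he => not_congr (hacc e he)]
    · rw [mul_zero]
  · intro e _
    rw [coordSum_direction_self hadj hT π e.2]
    split_ifs <;> simp
  · intro e _ e' _ hne
    exact coordSum_direction_of_ne hE hadj π e.2 e'.2 (Subtype.coe_ne_coe.2 hne.symm)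

end ConstantTerm

/-- main theorem for trees: let `T = (V, E)` be a tree on the well-ordered
variable set `V = Fin n` (edges are the pairs in `E`, oriented with `e.1 < e.2`), and
let `C = Π_x x^(w x + 1)` be a monomial of degree `n − 1`, where the weights
`w x ∈ {−1, 0, 1, 2, ...}` sum to `−1`.  For an edge `e = (x, y)`, `e` is regular iff
the component of `T ∖ e` containing `y` has negative total weight (exactly one of the
two components has negative total weight).  Then `DS_T(C)` equals
`(−1)^{#inversive edges}` times the number of `C`-acceptable permutations, where a
permutation `π` is `C`-acceptable iff for every edge `e = (x, y)`,
`π x < π y ↔ e` is regular. -/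
theorem divided_symmetrization_tree {K : Type*} [Field K] (n : ℕ)
    (E : Finset (Fin n × Fin n)) (hEo : ∀ e ∈ E, e.1 < e.2)
    (T : SimpleGraph (Fin n))
    (hadj : ∀ i j : Fin n, T.Adj i j ↔ (i, j) ∈ E ∨ (j, i) ∈ E)
    (hT : T.IsTree)
    (w : Fin n → ℤ) (hw1 : ∀ x, -1 ≤ w x) (hw : ∑ x, w x = -1) :
    DS E (∏ x, (X x : MvPolynomial (Fin n) K) ^ (w x + 1).toNat) =
      (((-1) ^ (E.filter fun e =>
            ¬ ∑ z ∈ Finset.univ.filter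
                (fun z => (T.deleteEdges {s(e.1, e.2)}).Reachable e.2 z), w z < 0).card *
          (Finset.univ.filter fun π : Equiv.Perm (Fin n) =>
            ∀ e ∈ E, (π e.1 < π e.2 ↔
              ∑ z ∈ Finset.univ.filter
                (fun z => (T.deleteEdges {s(e.1, e.2)}).Reachable e.2 z), w z < 0)).card :
        ℤ) : FractionRing (MvPolynomial (Fin n) K)) := by
  have hdeg : (∏ x, (X x : MvPolynomial (Fin n) K) ^ (w x + 1).toNat).totalDegree ≤ E.card := by
    have hcard := card_orderedEdges_add_one_of_isTree T E hEo hadj hT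
    rw [Fintype.card_fin] at hcard
    have hsum : ((∑ x, (w x + 1).toNat : ℕ) : ℤ) = E.card := by
      rw [Nat.cast_sum, Finset.sum_congr rfl fun x _ =>
        Int.toNat_of_nonneg (show 0 ≤ w x + 1 by linarith [hw1 x]), Finset.sum_add_distrib, hw]
      simp
      omega
    have hle := totalDegree_finsetProd Finset.univ
      fun x => (X x : MvPolynomial (Fin n) K) ^ (w x + 1).toNat
    simp only [totalDegree_X_pow] at hle
    exact hle.trans (by exact_mod_cast hsum.le)
  obtain ⟨c, hc⟩ := exists_const_divided_symmetrization E hEo _ hdeg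
  have hDS := hc (algebraMap (MvPolynomial (Fin n) K) (FractionRing (MvPolynomial (Fin n) K)))
    fun i j h => X_injective (IsFractionRing.injective _ _ h)
  have hHahn := congrArg (fun f => HahnSeries.coeff f 0) (hc (toHahn K n) toHahn_X_injective)
  simp only [HahnSeries.coeff_sum, coeff_zero_toHahn_div hEo hadj hT w hw1 hw, toHahn_C,
    HahnSeries.C_apply, HahnSeries.coeff_single_same] at hHahn
  rw [← Finset.sum_filter, Finset.sum_const, nsmul_eq_mul, mul_comm] at hHahn
  rw [DS, hDS, ← hHahn]
  simp only [upperComponent]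
  push_cast
  simp
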